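/- Let G be a context-free grammar and P the PDA obtained from G by the CFG2PDA transformation. Then L(G) = L(P). -/

import Mathlib

/-- The two-letter Dyck alphabet: `D.ab` is `ā` (the opening symbol) and `D.a` is `a`
(the closing symbol). -/
inductive D where
  | ab : D  -- ā
  | a : D   -- a
deriving DecidableEq

/-- Parse trees of the grammar `G_D = ({S}, {ā, a}, S, {S → ā S a S, S → ε})`:
`eps` is an application of `S → ε` and `node t₁ t₂` an application of `S → ā S a S`. -/
inductive DyckTree where
  | eps : DyckTree
  | node : DyckTree → DyckTree → DyckTree

/-- The word generated by a parse tree of `G_D`. -/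
def DyckTree.yield : DyckTree → List D
  | .eps => []
  | .node t₁ t₂ => D.ab :: (t₁.yield ++ D.a :: t₂.yield)

/-- The Dyck language `L_D`: the language generated by `G_D`. -/
def LD : Set (List D) := { w | ∃ t : DyckTree, t.yield = w }

/-- `Matches t i j` holds iff positions `i < j` (0-indexed) of the word `t.yield` form a
matching pair: position `i` carries `ā`, position `j` carries `a`, and the two
corresponding leaves have the same parent in the parse tree `t`. -/
inductive Matches : DyckTree → ℕ → ℕ → Prop
  | head (t₁ t₂ : DyckTree) : Matches (.node t₁ t₂) 0 (t₁.yield.length + 1)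
  | left {t₁ : DyckTree} {i j : ℕ} (t₂ : DyckTree) :
      Matches t₁ i j → Matches (.node t₁ t₂) (i + 1) (j + 1)
  | right {t₂ : DyckTree} {i j : ℕ} (t₁ : DyckTree) :
      Matches t₂ i j → Matches (.node t₁ t₂) (t₁.yield.length + 2 + i) (t₁.yield.length + 2 + j)

/-- `DelStep w v`: `v` results from `w ∈ L_D` by deleting (both positions of) one
matching pair of `w`. -/
def DelStep (w v : List D) : Prop :=
  ∃ (t : DyckTree) (i j : ℕ), t.yield = w ∧ Matches t i j ∧
    v = (w.eraseIdx j).eraseIdx i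

/-- The ordering `≼` on Dyck words: `dyckLE v w` (i.e. `v ≼ w`) holds iff `v` results
from `w` by deleting 0 or more matching pairs. -/
def dyckLE (v w : List D) : Prop := Relation.ReflTransGen DelStep w v

/-- The harmonics: `h_0 = ε` and `h_{i+1} = ā h_i a ā h_i a`. -/
def harmonicW : ℕ → List D
  | 0 => []
  | i + 1 => (D.ab :: (harmonicW i ++ [D.a])) ++ (D.ab :: (harmonicW i ++ [D.a]))

/-- `ĥ_i = ā h_i a`. -/
def hatHarmonic (i : ℕ) : List D := D.ab :: (harmonicW i ++ [D.a])

/-- The rank of a Dyck word `w`: the greatest `q` such that `h_q ≼ w`. -/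
noncomputable def rank (w : List D) : ℕ := sSup { q : ℕ | dyckLE (harmonicW q) w }

/-- A pushdown automaton with states `Q`, input alphabet `σ` and stack alphabet `Γ`
(the types `Q`, `σ`, `Γ` are meant to be finite, which is required where relevant):
`δ` is the set of actions, an action `(q, b, γ, p, ξ)` standing for
`(q, b, γ) ↪ (p, ξ)` with `b ∈ Σ ∪ {ε}` encoded by `Option σ`; `q0` is the start state
and `γ0` the start stack symbol. Acceptance is by empty stack. -/
structure PDA (Q σ Γ : Type) where
  δ : Set (Q × Option σ × Γ × Q × List Γ)
  q0 : Q
  γ0 : Γ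

/-- An instantaneous descriptor: state, remaining input, stack content. -/
structure ID (Q σ Γ : Type) where
  state : Q
  tape : List σ
  stack : List Γ

/-- The move relation: an action `(q, b, γ) ↪ (p, ξ′)` induces the move
`(q, b w, γ ξ) ⊢ (p, w, ξ′ ξ)`. -/
def PDA.Move {Q σ Γ : Type} (P : PDA Q σ Γ) (I I' : ID Q σ Γ) : Prop :=
  ∃ (b : Option σ) (γ : Γ) (ξ rest : List Γ),
    (I.state, b, γ, I'.state, ξ) ∈ P.δ ∧
    I.stack = γ :: rest ∧ I'.stack = ξ ++ rest ∧
    I.tape = b.toList ++ I'.tape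

/-- A quasi-run: a move sequence `I₀ ⊢ I₁ ⊢ … ⊢ I_m` such that the stack of `I₀` is a
single symbol and the stack of `I_m` is empty (represented as the list `[I₀, …, I_m]`). -/
def PDA.IsQuasiRun {Q σ Γ : Type} (P : PDA Q σ Γ) (r : List (ID Q σ Γ)) : Prop :=
  r.Chain' P.Move ∧
  (∃ (I : ID Q σ Γ) (γ : Γ), r.head? = some I ∧ I.stack = [γ]) ∧
  (∃ I' : ID Q σ Γ, r.getLast? = some I' ∧ I'.stack = [])

/-- A run on input `w`: a quasi-run whose first ID is the initial ID `(q₀, w, γ₀)` and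
whose last ID has empty tape (and, being a quasi-run, empty stack). -/
def PDA.IsRun {Q σ Γ : Type} (P : PDA Q σ Γ) (w : List σ) (r : List (ID Q σ Γ)) : Prop :=
  P.IsQuasiRun r ∧ r.head? = some ⟨P.q0, w, [P.γ0]⟩ ∧
  (∃ I' : ID Q σ Γ, r.getLast? = some I' ∧ I'.tape = [])

/-- The language of `P` (acceptance by empty stack). -/
def PDA.lang {Q σ Γ : Type} (P : PDA Q σ Γ) : Set (List σ) := { w | ∃ r, P.IsRun w r }

/-- The footprint `α′(r)` of a quasi-run `r = I₀, …, I_m`, defined in the paper by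
disassembly: `α′(r) = a` if `m = 1`, and `α′(r) = a ā^d α′(r₁) … α′(r_d)` if `m > 1`,
where `d = |stack(I₁)|` and `r₁, …, r_d` is the disassembly of `r`.  Equivalently
(unfolding the disassembly), each move `I ⊢ I'` contributes `a` (for the popped
symbol) followed by `ā^{|ξ|}` where `|ξ| = |stack(I')| + 1 − |stack(I)|` is the number
of pushed symbols; this computation is used here. -/
def alphaQR' {Q σ Γ : Type} : List (ID Q σ Γ) → List D
  | I :: I' :: rest =>
      (D.a :: List.replicate (I'.stack.length + 1 - I.stack.length) D.ab) ++
        alphaQR' (I' :: rest)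
  | _ => []

/-- The footprint `α(r) = ā α′(r)` of a quasi-run `r`. -/
def alphaQR {Q σ Γ : Type} (r : List (ID Q σ Γ)) : List D := D.ab :: alphaQR' r

/-- The oscillation of a quasi-run: `osc(r) = rank(α(r))`. -/
noncomputable def oscQR {Q σ Γ : Type} (r : List (ID Q σ Γ)) : ℕ := rank (alphaQR r)

/-- `L^(k)(P)`: the set of words accepted by some `k`-oscillating run of `P`. -/
noncomputable def PDA.oscLang {Q σ Γ : Type} (P : PDA Q σ Γ) (k : ℕ) : Set (List σ) :=
  { w | ∃ r, P.IsRun w r ∧ oscQR r = k }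

/-- A PDA is in reduced form if it has a single state (`Q = PUnit`) and each action
pops a symbol (`ξ = ε`) or pushes two symbols (`ξ ∈ Γ²`). -/
def PDA.Reduced {σ Γ : Type} (P : PDA PUnit σ Γ) : Prop :=
  ∀ a ∈ P.δ, (a.2.2.2.2 : List Γ).length = 2 ∨ a.2.2.2.2 = []

/-- For IDs `I, I'` with `stack(I) = ξ stack(I')`, `I/I' = (state(I), tape(I), ξ)`. -/
def quotID {Q σ Γ : Type} (I I' : ID Q σ Γ) : ID Q σ Γ :=
  ⟨I.state, I.tape, I.stack.take (I.stack.length - I'.stack.length)⟩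

instance {σ Γ : Type} : Inhabited (ID PUnit σ Γ) := ⟨⟨PUnit.unit, [], []⟩⟩

/-- The segment `I_s/I_e, I_{s+1}/I_e, …, I_e/I_e` of a quasi-run `r = I₀, …, I_m`,
for positions `s ≤ e`. -/
def segmentQR {σ Γ : Type} (r : List (ID PUnit σ Γ)) (s e : ℕ) : List (ID PUnit σ Γ) :=
  (List.range (e - s + 1)).map (fun j => quotID (r.getD (s + j) default) (r.getD e default))

/-- The CFG2PDA transformation (see statement); `none` encodes the fresh symbol `e`. -/
def cfg2pda {N T : Type} (R : Set (N × List (N ⊕ T))) (S : N) :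
    PDA PUnit T (Option (N ⊕ T)) where
  q0 := PUnit.unit
  γ0 := some (Sum.inl S)
  δ := { act |
    (∃ (X : N) (w : List (N ⊕ T)), (X, w) ∈ R ∧ w ≠ [] ∧
      act = (PUnit.unit, none, some (Sum.inl X), PUnit.unit, w.map some)) ∨
    (∃ X : N, (X, ([] : List (N ⊕ T))) ∈ R ∧
      act = (PUnit.unit, none, some (Sum.inl X), PUnit.unit, [none])) ∨
    (∃ b : T, act = (PUnit.unit, some b, some (Sum.inr b), PUnit.unit, [])) ∨
    act = (PUnit.unit, none, none, PUnit.unit, []) }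

/-- A derivation step of the grammar with rule set `R`: one occurrence of a variable
`X` in `u` is replaced by the right-hand side `w` of a rule `X → w`. -/
def GStep {N T : Type} (R : Set (N × List (N ⊕ T))) (u v : List (N ⊕ T)) : Prop :=
  ∃ (x y : List (N ⊕ T)) (X : N) (w : List (N ⊕ T)),
    (X, w) ∈ R ∧ u = x ++ Sum.inl X :: y ∧ v = x ++ w ++ y

/-- `L(G)`: the set of terminal words derivable from the start variable `S`. -/
def langCFG {N T : Type} (R : Set (N × List (N ⊕ T))) (S : N) : Set (List T) :=
  { w | Relation.ReflTransGen (GStep R) [Sum.inl S] (w.map Sum.inr) }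

/-!
STATEMENT 13: Let `G` be a context-free grammar and `P` the PDA obtained from `G` by
the CFG2PDA transformation. Then `L(G) = L(P)`.
-/

/-- `P` empties its stack `s` while reading exactly the word `w`. -/
def PDA.Accepts {σ Γ : Type} (P : PDA PUnit σ Γ) (w : List σ) (s : List Γ) : Prop :=
  Relation.ReflTransGen P.Move ⟨PUnit.unit, w, s⟩ ⟨PUnit.unit, [], []⟩

theorem PDA.mem_lang_iff_accepts {σ Γ : Type} (P : PDA PUnit σ Γ) (w : List σ) :
    w ∈ P.lang ↔ P.Accepts w [P.γ0] := by
  constructor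
  · rintro ⟨r, ⟨hchain, -, J, hJ, hstack⟩, hhead, J', hJ', htape⟩
    obtain rfl : J = J' := by simpa [hJ] using hJ'
    obtain ⟨q, t, s⟩ := J
    obtain rfl : s = [] := hstack
    obtain rfl : t = [] := htape
    cases r with
    | nil => simp at hhead
    | cons I l =>
      obtain rfl : I = ⟨P.q0, w, [P.γ0]⟩ := by simpa using hhead
      rw [List.getLast?_eq_some_getLast (List.cons_ne_nil _ _), Option.some_inj] at hJ
      exact List.relationReflTransGen_of_exists_isChain_cons l hchain hJ
  · intro h
    obtain ⟨l, hchain, hlast⟩ := List.exists_isChain_cons_of_relationReflTransGen h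
    have hlast' : (⟨P.q0, w, [P.γ0]⟩ :: l : List (ID PUnit σ Γ)).getLast? =
        some ⟨PUnit.unit, [], []⟩ := by
      rw [List.getLast?_eq_some_getLast (List.cons_ne_nil _ _)]
      exact congrArg some hlast
    exact ⟨⟨P.q0, w, [P.γ0]⟩ :: l,
      ⟨hchain, ⟨_, P.γ0, rfl, rfl⟩, _, hlast', rfl⟩, rfl, _, hlast', rfl⟩

theorem PDA.Accepts.of_action {σ Γ : Type} {P : PDA PUnit σ Γ} {b : Option σ} {γ : Γ}
    {ξ rest : List Γ} {w : List σ} (hδ : (PUnit.unit, b, γ, PUnit.unit, ξ) ∈ P.δ)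
    (h : P.Accepts w (ξ ++ rest)) : P.Accepts (b.toList ++ w) (γ :: rest) :=
  .head ⟨b, γ, ξ, rest, hδ, rfl, rfl, rfl⟩ h

section CFG2PDA

variable {N T : Type} {R : Set (N × List (N ⊕ T))} {S : N}

theorem cfg2pda_accepts_of_rule {X : N} {v : List (N ⊕ T)} (hXv : (X, v) ∈ R) {w : List T}
    {rest : List (Option (N ⊕ T))} (h : (cfg2pda R S).Accepts w (v.map some ++ rest)) :
    (cfg2pda R S).Accepts w (some (Sum.inl X) :: rest) := by
  by_cases hv : v = []
  · subst hv
    have hpop : (cfg2pda R S).Accepts w (none :: rest) :=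
      PDA.Accepts.of_action (b := none) (ξ := []) (by simp [cfg2pda]) h
    exact PDA.Accepts.of_action (b := none) (ξ := [none]) (.inr (.inl ⟨X, hXv, rfl⟩)) hpop
  · exact PDA.Accepts.of_action (b := none) (.inl ⟨X, v, hXv, hv, rfl⟩) h

theorem cfg2pda_accepts_of_rule_append {X : N} {v : List (N ⊕ T)} (hXv : (X, v) ∈ R) {w : List T}
    {x y : List (Option (N ⊕ T))} (h : (cfg2pda R S).Accepts w (x ++ (v.map some ++ y))) :
    (cfg2pda R S).Accepts w (x ++ some (Sum.inl X) :: y) := by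
  suffices ∀ I : ID PUnit T (Option (N ⊕ T)),
      Relation.ReflTransGen (cfg2pda R S).Move I ⟨PUnit.unit, [], []⟩ →
      ∀ x, I.stack = x ++ (v.map some ++ y) →
        (cfg2pda R S).Accepts I.tape (x ++ some (Sum.inl X) :: y) from this _ h x rfl
  intro I hI
  induction hI using Relation.ReflTransGen.head_induction_on with
  | refl =>
    rintro x hx
    obtain ⟨rfl, hvy⟩ := List.append_eq_nil_iff.1 hx.symm
    refine cfg2pda_accepts_of_rule hXv ?_
    rw [hvy]
    exact .refl
  | @head I I' hmove hrun ih =>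
    intro x hx
    cases x with
    | nil =>
      refine cfg2pda_accepts_of_rule hXv ?_
      have hI := Relation.ReflTransGen.head hmove hrun
      obtain ⟨q, t, s⟩ := I
      obtain rfl : s = v.map some ++ y := hx
      exact hI
    | cons γ x =>
      obtain ⟨b, γ', ξ, rest, hδ, hs, hs', ht⟩ := hmove
      rw [hx, List.cons_append, List.cons.injEq] at hs
      obtain ⟨rfl, rfl⟩ := hs
      rw [ht]
      refine PDA.Accepts.of_action hδ ?_
      have := ih (ξ ++ x) (by simpa using hs')
      simpa using this

theorem cfg2pda_accepts_map_inr (w : List T) :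
    (cfg2pda R S).Accepts w ((w.map Sum.inr).map some) := by
  induction w with
  | nil => exact .refl
  | cons b w ih =>
    exact PDA.Accepts.of_action (b := some b) (ξ := []) (.inr (.inr (.inl ⟨b, rfl⟩))) ih

theorem cfg2pda_accepts_of_derives {u : List (N ⊕ T)} {w : List T}
    (h : Relation.ReflTransGen (GStep R) u (w.map Sum.inr)) :
    (cfg2pda R S).Accepts w (u.map some) := by
  induction h using Relation.ReflTransGen.head_induction_on with
  | refl => exact cfg2pda_accepts_map_inr w
  | head hstep _ ih =>
    obtain ⟨x, y, X, v, hXv, rfl, rfl⟩ := hstep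
    simpa using cfg2pda_accepts_of_rule_append (x := x.map some) (y := y.map some) hXv
      (by simpa using ih)

theorem GStep.cons {u v : List (N ⊕ T)} (a : N ⊕ T) (h : GStep R u v) :
    GStep R (a :: u) (a :: v) := by
  obtain ⟨x, y, X, z, hXz, rfl, rfl⟩ := h
  exact ⟨a :: x, y, X, z, hXz, rfl, rfl⟩

theorem derives_of_cfg2pda_run {I : ID PUnit T (Option (N ⊕ T))}
    (h : Relation.ReflTransGen (cfg2pda R S).Move I ⟨PUnit.unit, [], []⟩) :
    Relation.ReflTransGen (GStep R) I.stack.reduceOption (I.tape.map Sum.inr) := by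
  induction h using Relation.ReflTransGen.head_induction_on with
  | refl => exact .refl
  | @head I I' hmove _ ih =>
    obtain ⟨b, γ, ξ, rest, hδ, hs, hs', ht⟩ := hmove
    rw [hs', List.reduceOption_append] at ih
    rw [hs, ht]
    rcases hδ with ⟨X, v, hXv, -, hact⟩ | ⟨X, hX, hact⟩ | ⟨c, hact⟩ | hact <;>
      simp only [Prod.mk.injEq, true_and] at hact <;> obtain ⟨rfl, rfl, rfl⟩ := hact
    · have hv : (v.map some).reduceOption = v := by simp [List.reduceOption]
      rw [hv] at ih
      exact .head ⟨[], rest.reduceOption, X, v, hXv, by simp, rfl⟩ (by simpa using ih)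
    · exact .head ⟨[], rest.reduceOption, X, [], hX, by simp, rfl⟩ (by simpa using ih)
    · simpa using ih.lift (Sum.inr c :: ·) fun _ _ => GStep.cons _
    · simpa using ih

end CFG2PDA

theorem cfg2pda_lang {N T : Type} [Finite N] [Finite T]
    (R : Set (N × List (N ⊕ T))) (hR : R.Finite) (S : N) :
    langCFG R S = (cfg2pda R S).lang := by
  ext w
  rw [PDA.mem_lang_iff_accepts]
  exact ⟨fun h => cfg2pda_accepts_of_derives h, fun h => derives_of_cfg2pda_run h⟩
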